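/- arXiv:1612.05892 — 4 statements merged into one kernel-verified Lean document; each statement's English description precedes it below -/
import Mathlib

section
/- Let (X,d) be a compact metric space and F = (f_n)_{n≥1} a sequence of homeomorphisms of X such that (X,F) has the shadowing property and the family {f_n, f_n^{-1} : n ≥ 1} is equi-continuous. Then every recurrent point of F is a chain recurrent point of F; in fact the closure C(F) of the set R(F) of recurrent points is contained in CR(F). -/
open Filter Topology Metric

/-- `FPos f n = f (n-1) ∘ ⋯ ∘ f 0` as a homeomorphism: the time-`n` map `F_n`. -/
def FPos {X : Type*} [TopologicalSpace X] (f : ℕ → X ≃ₜ X) : ℕ → X ≃ₜ X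
  | 0 => Homeomorph.refl X
  | n + 1 => (FPos f n).trans (f n)

/-- The two-sided family `F_n` (`n ∈ ℤ`), with `F_{-n} = (F_n)⁻¹`. -/
noncomputable def FZ {X : Type*} [TopologicalSpace X] (f : ℕ → X ≃ₜ X) (n : ℤ) : X → X :=
  if 0 ≤ n then (FPos f n.toNat : X → X) else ((FPos f (-n).toNat).symm : X → X)

/-- A bi-infinite `δ`-pseudo-orbit of the NDS given by the homeomorphisms `f`:
`d(f_{n+1}(x_n), x_{n+1}) < δ` for `n ≥ 0` and `d(f_{-n}⁻¹(x_{n+1}), x_n) < δ`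
for `n ≤ -1` (the map `f m` here is the `(m+1)`-st map of the system). -/
def IsPseudoOrbit {X : Type*} [MetricSpace X] (f : ℕ → X ≃ₜ X) (δ : ℝ) (x : ℤ → X) : Prop :=
  (∀ n : ℕ, dist (f n (x (n : ℤ))) (x ((n : ℤ) + 1)) < δ) ∧
  (∀ m : ℕ, dist ((f m).symm (x (-(m : ℤ)))) (x (-(m : ℤ) - 1)) < δ)

/-- The NDS has the shadowing property: every `δ`-pseudo-orbit is `ε`-traced. -/
def HasShadowing {X : Type*} [MetricSpace X] (f : ℕ → X ≃ₜ X) : Prop :=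
  ∀ ε > (0 : ℝ), ∃ δ > (0 : ℝ), ∀ x : ℤ → X, IsPseudoOrbit f δ x →
    ∃ y : X, ∀ n : ℤ, dist (FZ f n y) (x n) < ε

/-- A point `x` is recurrent: `x ∈ α(x) ∩ ω(x)`, i.e. `F_{n_k}(x) → x` along some
strictly decreasing sequence of negative integers and along some strictly
increasing sequence of positive integers. -/
def RecurrentPt {X : Type*} [MetricSpace X] (f : ℕ → X ≃ₜ X) (x : X) : Prop :=
  (∃ n : ℕ → ℤ, StrictAnti n ∧ (∀ k, n k < 0) ∧
    Tendsto (fun k => FZ f (n k) x) atTop (𝓝 x)) ∧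
  (∃ n : ℕ → ℤ, StrictMono n ∧ (∀ k, 0 < n k) ∧
    Tendsto (fun k => FZ f (n k) x) atTop (𝓝 x))

/-- A point `x` is chain recurrent for the NDS given by the homeomorphisms `f`. -/
def ChainRecurrent {X : Type*} [MetricSpace X] (f : ℕ → X ≃ₜ X) (x : X) : Prop :=
  ∀ δ > (0 : ℝ), ∀ n : ℕ, ∃ m ≥ n, ∃ k ≥ 1, ∃ c : ℕ → X, c 0 = x ∧ c k = x ∧
    ∀ i < k, dist (f (m + i) (c i)) (c (i + 1)) < δ ∨
      dist ((f (m + i)).symm (c i)) (c (i + 1)) < δ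

/-- The family `{f_n, f_n⁻¹ : n}` is equi-continuous. -/
def EquiContFamily {X : Type*} [MetricSpace X] (f : ℕ → X ≃ₜ X) : Prop :=
  ∀ ε > (0 : ℝ), ∃ δ > (0 : ℝ), ∀ x y : X, dist x y < δ → ∀ n : ℕ,
    dist (f n x) (f n y) < ε ∧ dist ((f n).symm x) ((f n).symm y) < ε

/-- If points arbitrarily close to `x` have forward orbits frequently returning near `x`, and the
family is equi-continuous, then `x` is chain recurrent. -/
theorem ChainRecurrent.of_frequently_dist_lt {X : Type*} [MetricSpace X] {f : ℕ → X ≃ₜ X}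
    (hequi : EquiContFamily f) {x : X}
    (h : ∀ ε > (0 : ℝ), ∃ y : X, ∃ᶠ n in atTop, dist (FPos f n y) x < ε) :
    ChainRecurrent f x := by
  intro δ hδ n
  obtain ⟨η, hη, hf⟩ := hequi (δ / 2) (half_pos hδ)
  obtain ⟨y, hy⟩ := h (min η (δ / 2)) (lt_min hη (half_pos hδ))
  rw [frequently_atTop] at hy
  obtain ⟨m, hm, hmx⟩ := hy n
  obtain ⟨p, hp, hpx⟩ := hy (m + 1)
  obtain ⟨k, rfl⟩ := Nat.exists_eq_add_of_le hp
  have hc : ∃ c : ℕ → X, c 0 = x ∧ c (1 + k) = x ∧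
      ∀ i, dist (FPos f (m + i) y) (c i) < min η (δ / 2) := by
    refine ⟨fun i => if i = 0 ∨ i = 1 + k then x else FPos f (m + i) y, by simp, by simp, ?_⟩
    intro i
    dsimp only
    split_ifs with hi
    · rcases hi with rfl | rfl
      · exact hmx
      · rwa [← add_assoc]
    · rw [dist_self]
      exact lt_min hη (half_pos hδ)
  obtain ⟨c, hc0, hck, hcd⟩ := hc
  refine ⟨m, hm, 1 + k, by omega, c, hc0, hck, fun i _ => Or.inl ?_⟩
  have h1 := (hf _ _ ((hcd i).trans_le (min_le_left _ _)) (m + i)).1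
  have h2 : dist (f (m + i) (FPos f (m + i) y)) (c (i + 1)) < δ / 2 :=
    (hcd (i + 1)).trans_le (min_le_right _ _)
  linarith [dist_triangle_left (f (m + i) (c i)) (c (i + 1)) (f (m + i) (FPos f (m + i) y))]

/-- The forward orbit of a recurrent point frequently enters each ball around that point. -/
theorem RecurrentPt.frequently_dist_lt {X : Type*} [MetricSpace X] {f : ℕ → X ≃ₜ X} {x : X}
    (hx : RecurrentPt f x) {ε : ℝ} (hε : 0 < ε) :
    ∃ᶠ n in atTop, dist (FPos f n x) x < ε := by
  obtain ⟨n, hn, hpos, hlim⟩ := hx.2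
  have hmono : StrictMono fun k => (n k).toNat := fun a b hab => by
    have := hn hab
    have := hpos a
    dsimp only
    omega
  refine hmono.tendsto_atTop.frequently (Eventually.frequently ?_)
  filter_upwards [hlim.eventually (ball_mem_nhds x hε)] with k hk
  rwa [FZ, if_pos (hpos k).le] at hk

/-- If an equi-continuous NDS of homeomorphisms of a compact metric space has the
shadowing property, then every recurrent point is chain recurrent; in fact the
closure `C(F)` of the recurrent set `R(F)` is contained in `CR(F)`. -/
theorem recurrent_subset_chainRecurrent
    {X : Type*} [MetricSpace X] [CompactSpace X] (f : ℕ → X ≃ₜ X)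
    (hshad : HasShadowing f) (hequi : EquiContFamily f) :
    (∀ x : X, RecurrentPt f x → ChainRecurrent f x) ∧
      closure {x : X | RecurrentPt f x} ⊆ {x : X | ChainRecurrent f x} := by
  have hcl : closure {x : X | RecurrentPt f x} ⊆ {x : X | ChainRecurrent f x} := by
    refine fun x hx => ChainRecurrent.of_frequently_dist_lt hequi fun ε hε => ?_
    obtain ⟨y, hy, hxy⟩ := Metric.mem_closure_iff.1 hx (ε / 2) (half_pos hε)
    refine ⟨y, (RecurrentPt.frequently_dist_lt hy (half_pos hε)).mono fun n hn => ?_⟩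
    linarith [dist_triangle_right (FPos f n y) x y]
  exact ⟨fun x hx => hcl (subset_closure hx), hcl⟩
end

section
/- Let (X,d) be a compact metric space and F = (f_n)_{n≥1} a sequence of homeomorphisms of X. Let X₀ be the space of all full orbits of F, i.e. bi-infinite sequences (x_n)_{n∈ℤ} with x_{n+1} = f_{n+1}(x_n) for n ≥ 0 and x_n = f_{-n}^{-1}(x_{n+1}) for n ≤ −1, equipped with the metric ρ(x,y) = Σ_{i∈ℤ} d(x_i,y_i)/2^{|i|}, and let σ₀ : X₀ → X₀ be the shift map. Then the classical topological entropy of σ₀ equals the topological entropy of the non-autonomous system: h(σ₀) = h(F). -/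
open Filter Topology Metric

/-- `orbitMap f n = f (n-1) ∘ ⋯ ∘ f 0`, i.e. the time-`n` map `F_n`. -/
def orbitMap {X : Type*} (f : ℕ → X → X) : ℕ → X → X
  | 0 => id
  | n + 1 => f n ∘ orbitMap f n

/-- Maximal cardinality of an `(n, F, ε)`-separated subset of `X`. -/
noncomputable def sepCard {X : Type*} [MetricSpace X] (f : ℕ → X → X) (n : ℕ) (ε : ℝ) : ℕ :=
  sSup {k | ∃ E : Finset X,
    (∀ x ∈ E, ∀ y ∈ E, x ≠ y → ∃ j < n, ε < dist (orbitMap f j x) (orbitMap f j y)) ∧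
    E.card = k}

/-- Topological entropy `h(F)` of the NDS `F`. -/
noncomputable def ndsEntropy {X : Type*} [MetricSpace X] (f : ℕ → X → X) : ℝ :=
  ⨆ ε : {e : ℝ // 0 < e}, atTop.limsup fun n => Real.log (sepCard f n ε) / n

/-- The metric `ρ(x, y) = Σ_{i ∈ ℤ} d(x_i, y_i) / 2^{|i|}` on bi-infinite sequences. -/
noncomputable def rho {X : Type*} [MetricSpace X] (x y : ℤ → X) : ℝ :=
  ∑' i : ℤ, dist (x i) (y i) / 2 ^ i.natAbs

/-- The shift map on bi-infinite sequences. -/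
def shiftMap {X : Type*} (x : ℤ → X) : ℤ → X := fun i => x (i + 1)

/-- A full orbit of the NDS given by the homeomorphisms `f`:
`x_{n+1} = f_{n+1}(x_n)` for `n ≥ 0` and `x_n = f_{-n}⁻¹(x_{n+1})` for `n ≤ -1`. -/
def IsFullOrbit {X : Type*} [TopologicalSpace X] (f : ℕ → X ≃ₜ X) (x : ℤ → X) : Prop :=
  (∀ n : ℕ, x ((n : ℤ) + 1) = f n (x (n : ℤ))) ∧
  (∀ m : ℕ, x (-(m : ℤ) - 1) = (f m).symm (x (-(m : ℤ))))

/-- Maximal cardinality of an `(n, ε)`-separated (for the metric `ρ` and the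
shift map `σ₀`) set of full orbits of `f`: the Bowen separated-set count for the
classical system `(X₀, σ₀)`. -/
noncomputable def shiftSepCard {X : Type*} [MetricSpace X] (f : ℕ → X ≃ₜ X)
    (n : ℕ) (ε : ℝ) : ℕ :=
  sSup {k | ∃ E : Finset (ℤ → X), (∀ x ∈ E, IsFullOrbit f x) ∧
    (∀ x ∈ E, ∀ y ∈ E, x ≠ y → ∃ j < n, ε < rho (shiftMap^[j] x) (shiftMap^[j] y)) ∧
    E.card = k}

/-- Classical topological entropy of the shift `σ₀` on the compact metric space
`(X₀, ρ)` of full orbits. -/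
noncomputable def shiftEntropy {X : Type*} [MetricSpace X] (f : ℕ → X ≃ₜ X) : ℝ :=
  ⨆ ε : {e : ℝ // 0 < e}, atTop.limsup fun n => Real.log (shiftSepCard f n ε) / n

section Separated

variable {X : Type*} [MetricSpace X]

theorem exists_card_le_pow_of_separated [CompactSpace X] {ε : ℝ} (hε : 0 < ε) :
    ∃ N : ℕ, ∀ (f : ℕ → X → X) (n : ℕ) (E : Finset X),
      (∀ x ∈ E, ∀ y ∈ E, x ≠ y → ∃ j < n, ε < dist (orbitMap f j x) (orbitMap f j y)) →
      E.card ≤ N ^ n := by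
  obtain ⟨t, -, ht, hcover⟩ :=
    finite_cover_balls_of_compact (isCompact_univ (X := X)) (half_pos hε)
  have hcenter : ∀ x : X, ∃ c : t, dist x c < ε / 2 := fun x => by
    obtain ⟨c, hc, hx⟩ := Set.mem_iUnion₂.1 (hcover (Set.mem_univ x))
    exact ⟨⟨c, hc⟩, hx⟩
  choose c hc using hcenter
  have := ht.fintype
  refine ⟨Fintype.card t, fun f n E hE => ?_⟩
  have hinj : Set.InjOn (fun x (j : Fin n) => c (orbitMap f j x)) E := by
    intro x hx y hy hxy
    by_contra hne
    obtain ⟨j, hj, hlt⟩ := hE x hx y hy hne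
    have hcxy : c (orbitMap f j x) = c (orbitMap f j y) := congrFun hxy ⟨j, hj⟩
    have h₁ := hc (orbitMap f j x)
    have h₂ := hc (orbitMap f j y)
    rw [hcxy] at h₁
    linarith [dist_triangle_right (orbitMap f j x) (orbitMap f j y) (c (orbitMap f j y))]
  simpa using Finset.card_le_card_of_injOn (t := Finset.univ) _ (fun _ _ => by simp) hinj

theorem bddAbove_separated_card [CompactSpace X] (f : ℕ → X → X) (n : ℕ) {ε : ℝ} (hε : 0 < ε) :
    BddAbove {k | ∃ E : Finset X,
      (∀ x ∈ E, ∀ y ∈ E, x ≠ y → ∃ j < n, ε < dist (orbitMap f j x) (orbitMap f j y)) ∧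
      E.card = k} := by
  obtain ⟨N, hN⟩ := exists_card_le_pow_of_separated (X := X) hε
  refine ⟨N ^ n, ?_⟩
  rintro k ⟨E, hE, rfl⟩
  exact hN f n E hE

theorem exists_log_sepCard_div_le [CompactSpace X] (f : ℕ → X → X) {ε : ℝ} (hε : 0 < ε) :
    ∃ C : ℝ, ∀ n : ℕ, Real.log (sepCard f n ε) / n ≤ C := by
  obtain ⟨N, hN⟩ := exists_card_le_pow_of_separated (X := X) hε
  refine ⟨Real.log N, fun n => div_le_of_le_mul₀ n.cast_nonneg (Real.log_natCast_nonneg N) ?_⟩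
  have hle : sepCard f n ε ≤ N ^ n := csSup_le' (by
    rintro k ⟨E, hE, rfl⟩
    exact hN f n E hE)
  rcases Nat.eq_zero_or_pos (sepCard f n ε) with h0 | hpos
  · rw [h0]
    simpa using mul_nonneg (Real.log_natCast_nonneg N) n.cast_nonneg
  · calc Real.log (sepCard f n ε) ≤ Real.log ((N : ℝ) ^ n) :=
          Real.log_le_log (by exact_mod_cast hpos) (by exact_mod_cast hle)
      _ = Real.log N * n := by rw [Real.log_pow, mul_comm]

end Separated

section Orbits

variable {X : Type*} [TopologicalSpace X]

theorem continuous_orbitMap {f : ℕ → X → X} (hf : ∀ n, Continuous (f n)) (n : ℕ) :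
    Continuous (orbitMap f n) := by
  induction n with
  | zero => exact continuous_id
  | succ n ih => exact (hf n).comp ih

theorem IsFullOrbit.apply_natCast {f : ℕ → X ≃ₜ X} {x : ℤ → X} (hx : IsFullOrbit f x) (n : ℕ) :
    x n = orbitMap (fun n => (f n : X → X)) n (x 0) := by
  induction n with
  | zero => rfl
  | succ n ih => rw [Nat.cast_succ, hx.1, ih]; rfl

theorem IsFullOrbit.apply_neg_natCast {f : ℕ → X ≃ₜ X} {x : ℤ → X} (hx : IsFullOrbit f x)
    (n : ℕ) : x (-n) = orbitMap (fun n => ((f n).symm : X → X)) n (x 0) := by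
  induction n with
  | zero => rfl
  | succ n ih => rw [Nat.cast_succ, neg_add', hx.2, ih]; rfl

/-- The full orbit of `f` passing through `x` at time `0`. -/
def fullOrbit (f : ℕ → X ≃ₜ X) (x : X) : ℤ → X
  | Int.ofNat n => orbitMap (fun n => (f n : X → X)) n x
  | Int.negSucc n => orbitMap (fun n => ((f n).symm : X → X)) (n + 1) x

theorem isFullOrbit_fullOrbit (f : ℕ → X ≃ₜ X) (x : X) : IsFullOrbit f (fullOrbit f x) := by
  refine ⟨fun n => rfl, fun m => ?_⟩
  cases m with
  | zero => rfl
  | succ m =>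
    have h₁ : -((m + 1 : ℕ) : ℤ) - 1 = Int.negSucc (m + 1) := by omega
    have h₂ : -((m + 1 : ℕ) : ℤ) = Int.negSucc m := by omega
    rw [h₁, h₂]
    rfl

theorem shiftMap_iterate_apply {Y : Type*} (j : ℕ) (x : ℤ → Y) (i : ℤ) :
    (shiftMap^[j] x) i = x (i + j) := by
  induction j generalizing x with
  | zero => simp
  | succ j ih =>
    rw [Function.iterate_succ_apply, ih, shiftMap]
    congr 1
    push_cast
    ring

end Orbits

section Rho

variable {X : Type*} [MetricSpace X]

theorem summable_one_div_two_pow_natAbs : Summable fun i : ℤ => (1 : ℝ) / 2 ^ i.natAbs := by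
  apply Summable.of_nat_of_neg <;> simpa [← inv_pow] using summable_geometric_two

variable [CompactSpace X]

theorem dist_div_two_pow_natAbs_le (x y : ℤ → X) (i : ℤ) :
    dist (x i) (y i) / 2 ^ i.natAbs ≤ diam (Set.univ : Set X) * (1 / 2 ^ i.natAbs) := by
  rw [mul_one_div]
  gcongr
  exact dist_le_diam_of_mem isCompact_univ.isBounded (Set.mem_univ _) (Set.mem_univ _)

theorem summable_rho (x y : ℤ → X) :
    Summable fun i : ℤ => dist (x i) (y i) / 2 ^ i.natAbs :=
  (summable_one_div_two_pow_natAbs.mul_left _).of_nonneg_of_le (fun _ => by positivity)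
    (dist_div_two_pow_natAbs_le x y)

theorem dist_apply_zero_le_rho (x y : ℤ → X) : dist (x 0) (y 0) ≤ rho x y := by
  simpa [rho] using (summable_rho x y).le_tsum 0 (fun _ _ => by positivity)

theorem exists_forall_dist_le_imp_rho_le {ε : ℝ} (hε : 0 < ε) :
    ∃ k : ℕ, ∃ δ > 0, ∀ x y : ℤ → X,
      (∀ i : ℤ, i.natAbs ≤ k → dist (x i) (y i) ≤ δ) → rho x y ≤ ε := by
  have hsum := summable_one_div_two_pow_natAbs.mul_left (diam (Set.univ : Set X))
  obtain ⟨s, hs⟩ := ((tendsto_order.1 (tendsto_tsum_compl_atTop_zero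
    fun i : ℤ => diam (Set.univ : Set X) * (1 / 2 ^ i.natAbs))).2 _ (half_pos hε)).exists
  set C : ℝ := ∑ i ∈ s, (1 : ℝ) / 2 ^ i.natAbs
  have hC : 0 ≤ C := Finset.sum_nonneg fun _ _ => by positivity
  refine ⟨s.sup Int.natAbs, ε / 2 / (C + 1), by positivity, fun x y hxy => ?_⟩
  rw [rho, ← (summable_rho x y).sum_add_tsum_compl (s := s)]
  have hfin : ∑ i ∈ s, dist (x i) (y i) / 2 ^ i.natAbs ≤ ε / 2 / (C + 1) * C := by
    rw [Finset.mul_sum]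
    refine Finset.sum_le_sum fun i hi => ?_
    rw [mul_one_div]
    gcongr
    exact hxy i (Finset.le_sup hi)
  have hfin' : ε / 2 / (C + 1) * C ≤ ε / 2 := by
    rw [div_mul_eq_mul_div, div_le_iff₀ (by positivity)]
    nlinarith
  have htail : ∑' i : ↑((s : Set ℤ)ᶜ), dist (x i) (y i) / 2 ^ (i : ℤ).natAbs ≤
      ∑' i : ↑((s : Set ℤ)ᶜ), diam (Set.univ : Set X) * (1 / 2 ^ (i : ℤ).natAbs) :=
    ((summable_rho x y).subtype _).tsum_le_tsum (fun i => dist_div_two_pow_natAbs_le x y i)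
      (hsum.subtype _)
  have hs' : ∑' i : ↑((s : Set ℤ)ᶜ), diam (Set.univ : Set X) * (1 / 2 ^ (i : ℤ).natAbs) <
      ε / 2 := hs
  linarith

theorem IsFullOrbit.exists_forall_dist_neg_le (f : ℕ → X ≃ₜ X) (k : ℕ) {ε : ℝ} (hε : 0 < ε) :
    ∃ δ > 0, ∀ x y : ℤ → X, IsFullOrbit f x → IsFullOrbit f y → dist (x 0) (y 0) ≤ δ →
      ∀ m ≤ k, dist (x (-(m : ℕ))) (y (-(m : ℕ))) ≤ ε := by
  induction k with
  | zero => exact ⟨ε, hε, fun x y _ _ h m hm => by simpa [Nat.le_zero.1 hm] using h⟩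
  | succ k ih =>
    obtain ⟨δ, hδ, ih⟩ := ih
    have huc := CompactSpace.uniformContinuous_of_continuous
      (continuous_orbitMap (fun n => (f n).symm.continuous) (k + 1))
    obtain ⟨η, hη, huc⟩ := Metric.uniformContinuous_iff.1 huc ε hε
    refine ⟨min δ (η / 2), by positivity, fun x y hx hy hxy m hm => ?_⟩
    rcases Nat.le_succ_iff.1 hm with hm | rfl
    · exact ih x y hx hy (hxy.trans (min_le_left _ _)) m hm
    · rw [hx.apply_neg_natCast, hy.apply_neg_natCast]
      exact (huc (lt_of_le_of_lt (hxy.trans (min_le_right _ _)) (half_lt_self hη))).le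

theorem exists_forall_card_le_sepCard (f : ℕ → X ≃ₜ X) {ε : ℝ} (hε : 0 < ε) :
    ∃ k : ℕ, ∃ δ > 0, ∀ (n : ℕ) (E : Finset (ℤ → X)), (∀ x ∈ E, IsFullOrbit f x) →
      (∀ x ∈ E, ∀ y ∈ E, x ≠ y → ∃ j < n, ε < rho (shiftMap^[j] x) (shiftMap^[j] y)) →
      E.card ≤ sepCard (fun n => (f n : X → X)) (n + k) δ := by
  classical
  obtain ⟨k, η, hη, hrho⟩ := exists_forall_dist_le_imp_rho_le (X := X) hε
  obtain ⟨δ, hδ, hneg⟩ := IsFullOrbit.exists_forall_dist_neg_le f k hη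
  refine ⟨k + 1, min δ η, by positivity, fun n E horb hsep => ?_⟩
  have hforward : ∀ x ∈ E, ∀ y ∈ E, x ≠ y → ∃ j < n + (k + 1), min δ η <
      dist (orbitMap (fun n => (f n : X → X)) j (x 0))
        (orbitMap (fun n => (f n : X → X)) j (y 0)) := by
    intro x hx y hy hne
    by_contra! hclose
    obtain ⟨j, hj, hlt⟩ := hsep x hx y hy hne
    refine hlt.not_ge (hrho _ _ fun i hi => ?_)
    rw [shiftMap_iterate_apply, shiftMap_iterate_apply]
    rcases le_total 0 (i + j) with h | h
    · obtain ⟨m, hm⟩ := Int.eq_ofNat_of_zero_le h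
      rw [hm, (horb x hx).apply_natCast, (horb y hy).apply_natCast]
      exact (hclose m (by omega)).trans (min_le_right _ _)
    · obtain ⟨m, hm⟩ := Int.exists_eq_neg_ofNat h
      rw [hm]
      exact hneg x y (horb x hx) (horb y hy)
        ((hclose 0 (by omega)).trans (min_le_left _ _)) m (by omega)
  have hinj : Set.InjOn (fun x : ℤ → X => x 0) E := by
    intro x hx y hy hxy
    by_contra hne
    obtain ⟨j, -, hlt⟩ := hforward x hx y hy hne
    rw [show x 0 = y 0 from hxy, dist_self] at hlt
    exact absurd hlt (not_lt.2 (by positivity))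
  refine le_csSup (bddAbove_separated_card _ _ (by positivity))
    ⟨E.image fun x => x 0, ?_, Finset.card_image_of_injOn hinj⟩
  intro a ha b hb hab
  obtain ⟨x, hx, rfl⟩ := Finset.mem_image.1 ha
  obtain ⟨y, hy, rfl⟩ := Finset.mem_image.1 hb
  exact hforward x hx y hy fun h => hab (by rw [h])

theorem exists_forall_shiftSepCard_le (f : ℕ → X ≃ₜ X) {ε : ℝ} (hε : 0 < ε) :
    ∃ k : ℕ, ∃ δ > 0, ∀ n : ℕ,
      shiftSepCard f n ε ≤ sepCard (fun n => (f n : X → X)) (n + k) δ := by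
  obtain ⟨k, δ, hδ, h⟩ := exists_forall_card_le_sepCard f hε
  refine ⟨k, δ, hδ, fun n => csSup_le' ?_⟩
  rintro m ⟨E, horb, hsep, rfl⟩
  exact h n E horb hsep

theorem sepCard_le_shiftSepCard (f : ℕ → X ≃ₜ X) (n : ℕ) {ε : ℝ} (hε : 0 < ε) :
    sepCard (fun n => (f n : X → X)) n ε ≤ shiftSepCard f n ε := by
  classical
  refine csSup_le' ?_
  rintro m ⟨E, hE, rfl⟩
  obtain ⟨k, δ, -, hbdd⟩ := exists_forall_card_le_sepCard f hε
  have hinj : Function.Injective (fullOrbit f) := fun x y h => congrFun h 0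
  refine le_csSup ⟨sepCard (fun n => (f n : X → X)) (n + k) δ, ?_⟩
    ⟨E.image (fullOrbit f), ?_, ?_, Finset.card_image_of_injective E hinj⟩
  · rintro m ⟨E, horb, hsep, rfl⟩
    exact hbdd n E horb hsep
  · intro x hx
    obtain ⟨a, -, rfl⟩ := Finset.mem_image.1 hx
    exact isFullOrbit_fullOrbit f a
  · intro x hx y hy hxy
    obtain ⟨a, ha, rfl⟩ := Finset.mem_image.1 hx
    obtain ⟨b, hb, rfl⟩ := Finset.mem_image.1 hy
    obtain ⟨j, hj, hlt⟩ := hE a ha b hb fun h => hxy (by rw [h])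
    refine ⟨j, hj, hlt.trans_le (le_trans (le_of_eq ?_) (dist_apply_zero_le_rho _ _))⟩
    rw [shiftMap_iterate_apply, shiftMap_iterate_apply, zero_add]
    rfl

end Rho

section GrowthRate

theorem log_natCast_mono {a b : ℕ} (h : a ≤ b) : Real.log a ≤ Real.log b := by
  rcases Nat.eq_zero_or_pos a with rfl | ha
  · simpa using Real.log_natCast_nonneg b
  · exact Real.log_le_log (by exact_mod_cast ha) (by exact_mod_cast h)

theorem log_natCast_div_nonneg (a : ℕ → ℕ) (n : ℕ) : 0 ≤ Real.log (a n) / n :=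
  div_nonneg (Real.log_natCast_nonneg _) n.cast_nonneg

theorem isCoboundedUnder_log_natCast_div (a : ℕ → ℕ) :
    IsCoboundedUnder (· ≤ ·) atTop fun n => Real.log (a n) / (n : ℝ) :=
  isCoboundedUnder_le_of_le atTop (x := 0) (log_natCast_div_nonneg a)

theorem log_natCast_div_le_of_le_add {a b : ℕ → ℕ} {k : ℕ} (hab : ∀ n, a n ≤ b (n + k))
    {C : ℝ} (hC : ∀ n, Real.log (b n) / n ≤ C) {n : ℕ} (hn : 0 < n) :
    Real.log (a n) / n ≤ Real.log (b (n + k)) / (n + k : ℕ) + C * k / n := by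
  have hn' : (0 : ℝ) < n := by exact_mod_cast hn
  have hnk : (0 : ℝ) < (n + k : ℕ) := by exact_mod_cast Nat.add_pos_left hn k
  calc Real.log (a n) / n ≤ Real.log (b (n + k)) / n := by
        exact div_le_div_of_nonneg_right (log_natCast_mono (hab n)) hn'.le
    _ = Real.log (b (n + k)) / (n + k : ℕ) + Real.log (b (n + k)) / (n + k : ℕ) * k / n := by
        push_cast at hnk ⊢
        field_simp
    _ ≤ _ := by
        gcongr
        exact hC _

theorem limsup_log_natCast_div_le_of_le_add {a b : ℕ → ℕ} {k : ℕ}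
    (hab : ∀ n, a n ≤ b (n + k)) {C : ℝ} (hC : ∀ n, Real.log (b n) / n ≤ C) :
    atTop.limsup (fun n => Real.log (a n) / (n : ℝ)) ≤
      atTop.limsup fun n => Real.log (b n) / (n : ℝ) := by
  refine le_of_forall_pos_le_add fun η hη => ?_
  refine limsup_le_of_le (isCoboundedUnder_log_natCast_div a) ?_
  have hb : ∀ᶠ n : ℕ in atTop, Real.log (b n) / (n : ℝ) <
      atTop.limsup (fun n => Real.log (b n) / (n : ℝ)) + η / 2 :=
    eventually_lt_of_limsup_lt (lt_add_of_pos_right _ (half_pos hη))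
      (isBoundedUnder_of ⟨C, hC⟩)
  have hsmall : ∀ᶠ n : ℕ in atTop, C * k / (n : ℝ) < η / 2 :=
    (tendsto_const_div_atTop_nhds_zero_nat (C * k)).eventually_lt_const (half_pos hη)
  filter_upwards [(tendsto_add_atTop_nat k).eventually hb, hsmall, eventually_gt_atTop 0]
    with n h₁ h₂ hn
  linarith [log_natCast_div_le_of_le_add hab hC hn]

end GrowthRate

/-- Mutually cofinal real families have the same supremum, including when both are unbounded. -/
theorem Real.iSup_eq_iSup_of_cofinal {ι κ : Type*} [Nonempty ι] [Nonempty κ]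
    {u : ι → ℝ} {v : κ → ℝ} (huv : ∀ i, ∃ j, u i ≤ v j) (hvu : ∀ j, ∃ i, v j ≤ u i) :
    ⨆ i, u i = ⨆ j, v j := by
  have hbdd : BddAbove (Set.range u) ↔ BddAbove (Set.range v) := by
    constructor
    · rintro ⟨M, hM⟩
      refine ⟨M, Set.forall_mem_range.2 fun j => ?_⟩
      obtain ⟨i, hi⟩ := hvu j
      exact hi.trans (hM ⟨i, rfl⟩)
    · rintro ⟨M, hM⟩
      refine ⟨M, Set.forall_mem_range.2 fun i => ?_⟩
      obtain ⟨j, hj⟩ := huv i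
      exact hj.trans (hM ⟨j, rfl⟩)
  by_cases hu : BddAbove (Set.range u)
  · refine le_antisymm (ciSup_le fun i => ?_) (ciSup_le fun j => ?_)
    · obtain ⟨j, hj⟩ := huv i
      exact hj.trans (le_ciSup (hbdd.1 hu) j)
    · obtain ⟨i, hi⟩ := hvu j
      exact hi.trans (le_ciSup hu i)
  · rw [Real.iSup_of_not_bddAbove hu, Real.iSup_of_not_bddAbove (mt hbdd.2 hu)]

/-- `h(σ₀) = h(F)`: the classical entropy of the shift on the orbit space `X₀`
equals the topological entropy of the non-autonomous system. -/
theorem shiftEntropy_eq_ndsEntropy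
    {X : Type*} [MetricSpace X] [CompactSpace X] (f : ℕ → X ≃ₜ X) :
    shiftEntropy f = ndsEntropy (fun n => (f n : X → X)) := by
  have : Nonempty {e : ℝ // 0 < e} := ⟨⟨1, one_pos⟩⟩
  refine Real.iSup_eq_iSup_of_cofinal (fun ε => ?_) fun ε => ⟨ε, ?_⟩
  · obtain ⟨k, δ, hδ, hle⟩ := exists_forall_shiftSepCard_le f ε.2
    obtain ⟨C, hC⟩ := exists_log_sepCard_div_le (fun n => (f n : X → X)) hδ
    exact ⟨⟨δ, hδ⟩, limsup_log_natCast_div_le_of_le_add hle hC⟩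
  · obtain ⟨k, δ, hδ, hle⟩ := exists_forall_shiftSepCard_le f ε.2
    obtain ⟨C, hC⟩ := exists_log_sepCard_div_le (fun n => (f n : X → X)) hδ
    have hbdd : IsBoundedUnder (· ≤ ·) atTop
        fun n : ℕ => Real.log (shiftSepCard f n ε) / (n : ℝ) := by
      refine isBoundedUnder_of_eventually_le (a := C + max (C * k) 0) ?_
      filter_upwards [eventually_gt_atTop 0] with n hn
      have hn' : (1 : ℝ) ≤ n := by exact_mod_cast hn
      have h₁ : C * k / n ≤ max (C * k) 0 := (div_le_div_of_nonneg_right (le_max_left _ _)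
        n.cast_nonneg).trans (div_le_self (le_max_right _ _) hn')
      linarith [log_natCast_div_le_of_le_add hle hC hn, hC (n + k)]
    refine limsup_le_limsup (Eventually.of_forall fun n => ?_)
      (isCoboundedUnder_log_natCast_div _) hbdd
    exact div_le_div_of_nonneg_right (log_natCast_mono (sepCard_le_shiftSepCard f n ε.2))
      n.cast_nonneg
end

section
/- Let (X,d) be a compact metric space and (X,F) a chain transitive non-autonomous dynamical system. Then for every α > 0 there is a positive integer K such that for every pair x, y ∈ X there is a (2α,F)-chain from x to y of length less than or equal to K. -/
open Filter Topology Metric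

/-- An `(α, F)`-chain of length `k` from `x` to `y`: a finite sequence
`x_0 = x, …, x_k = y` with `d(f_{i+1}(x_i), x_{i+1}) < α` for `0 ≤ i ≤ k - 1`
(here the maps are 0-indexed, so the step `i` uses `f i`). -/
def IsChainFromTo {X : Type*} [MetricSpace X] (f : ℕ → X → X) (α : ℝ) (k : ℕ)
    (x y : X) : Prop :=
  ∃ c : ℕ → X, c 0 = x ∧ c k = y ∧ ∀ i < k, dist (f i (c i)) (c (i + 1)) < α

/-- The NDS `(X, F)` is chain transitive: for every `α > 0` and all `x, y` there
are `(α, F)`-chains from `x` to `y` and from `y` to `x`. -/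
def ChainTransitive {X : Type*} [MetricSpace X] (f : ℕ → X → X) : Prop :=
  ∀ α > (0 : ℝ), ∀ x y : X,
    (∃ k, IsChainFromTo f α k x y) ∧ (∃ k, IsChainFromTo f α k y x)

theorem IsChainFromTo.pos_of_ne {X : Type*} [MetricSpace X] {f : ℕ → X → X} {α : ℝ} {k : ℕ}
    {x y : X} (h : IsChainFromTo f α k x y) (hxy : x ≠ y) : 0 < k := by
  obtain ⟨c, h0, hk, -⟩ := h
  rcases Nat.eq_zero_or_pos k with rfl | hpos
  · exact absurd (h0.symm.trans hk) hxy
  · exact hpos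

/-- The endpoints of a nontrivial `α`-chain can be perturbed, the final one by less than `α`,
at the cost of passing to a `2α`-chain. -/
theorem IsChainFromTo.eventually_nhds {X : Type*} [MetricSpace X] {f : ℕ → X → X} {α : ℝ} {k : ℕ}
    {x y z : X} (hf : Continuous (f 0)) (hα : 0 < α) (hk : 0 < k)
    (h : IsChainFromTo f α k x z) (hzy : dist z y < α) :
    ∀ᶠ p : X × X in 𝓝 (x, y), IsChainFromTo f (2 * α) k p.1 p.2 := by
  obtain ⟨c, h0, hck, hc⟩ := h
  have hstart : ∀ᶠ p : X × X in 𝓝 (x, y), dist (f 0 p.1) (c 1) < α := by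
    refine (isOpen_lt (by fun_prop) continuous_const).mem_nhds ?_
    simpa [h0] using hc 0 hk
  have hend : ∀ᶠ p : X × X in 𝓝 (x, y), dist z p.2 < α :=
    (isOpen_lt (by fun_prop) continuous_const).mem_nhds hzy
  filter_upwards [hstart, hend] with p hp hp'
  refine ⟨fun i => if i = 0 then p.1 else if i = k then p.2 else c i, by simp, by simp [hk.ne'],
    fun i hi => ?_⟩
  have hstep : dist (f i (if i = 0 then p.1 else c i)) (c (i + 1)) < α := by
    split_ifs with hi0
    · simpa [hi0] using hp
    · exact hc i hi
  simp only [hi.ne, if_false, Nat.add_eq_zero_iff, one_ne_zero, and_false]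
  split_ifs at hstep ⊢ with hi0 hik hik
  all_goals first
    | linarith
    | rw [hik, hck] at hstep
      exact (dist_triangle _ z _).trans_lt (by linarith)

theorem ChainTransitive.exists_eventually_nhds {X : Type*} [MetricSpace X] {f : ℕ → X → X}
    (hf : Continuous (f 0)) (htrans : ChainTransitive f) {α : ℝ} (hα : 0 < α) (x y : X) :
    ∃ k, ∀ᶠ p : X × X in 𝓝 (x, y), IsChainFromTo f (2 * α) k p.1 p.2 := by
  by_cases hz : ∃ z, x ≠ z ∧ dist z y < α
  · obtain ⟨z, hxz, hzy⟩ := hz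
    obtain ⟨k, hk⟩ := (htrans α hα x z).1
    exact ⟨k, hk.eventually_nhds hf hα (hk.pos_of_ne hxz) hzy⟩
  · push Not at hz
    have hxy : x = y := by
      by_contra hne
      exact absurd (hz y hne) (by simpa using hα)
    subst hxy
    have hball : ∀ w, dist w x < α → x = w := fun w hw => by
      by_contra hne
      exact absurd (hz w hne) (not_le.mpr hw)
    refine ⟨0, ?_⟩
    filter_upwards [prod_mem_nhds (ball_mem_nhds x hα) (ball_mem_nhds x hα)] with p hp
    exact ⟨fun _ => p.1, rfl, (hball _ hp.1).symm.trans (hball _ hp.2), by simp⟩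

/-- If a chain transitive NDS on a compact metric space is given, then for every
`α > 0` there is a positive integer `K` such that every pair of points is joined
by a `(2α, F)`-chain of length at most `K`. -/
theorem exists_uniform_chain_length_of_chainTransitive
    {X : Type*} [MetricSpace X] [CompactSpace X] (f : ℕ → X → X)
    (hf : ∀ n, Continuous (f n)) (htrans : ChainTransitive f) :
    ∀ α > (0 : ℝ), ∃ K : ℕ, 0 < K ∧
      ∀ x y : X, ∃ k ≤ K, IsChainFromTo f (2 * α) k x y := by
  intro α hα
  obtain ⟨K, hK⟩ : ∃ K : ℕ, ∀ p ∈ (Set.univ : Set (X × X)),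
      ∃ k ≤ K, IsChainFromTo f (2 * α) k p.1 p.2 := by
    refine isCompact_univ.induction_on
      (p := fun s : Set (X × X) => ∃ K : ℕ, ∀ p ∈ s, ∃ k ≤ K, IsChainFromTo f (2 * α) k p.1 p.2)
      ⟨0, by simp⟩ (fun s t hst ⟨K, hK⟩ => ⟨K, fun p hp => hK p (hst hp)⟩) ?_ ?_
    · rintro s t ⟨K, hK⟩ ⟨L, hL⟩
      refine ⟨max K L, ?_⟩
      rintro p (hp | hp)
      · obtain ⟨k, hk, h⟩ := hK p hp
        exact ⟨k, le_max_of_le_left hk, h⟩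
      · obtain ⟨k, hk, h⟩ := hL p hp
        exact ⟨k, le_max_of_le_right hk, h⟩
    · rintro ⟨x, y⟩ -
      obtain ⟨k, hk⟩ := htrans.exists_eventually_nhds (hf 0) hα x y
      exact ⟨_, mem_nhdsWithin_of_mem_nhds hk, k, fun p hp => ⟨k, le_rfl, hp⟩⟩
  refine ⟨K + 1, K.succ_pos, fun x y => ?_⟩
  obtain ⟨k, hk, h⟩ := hK (x, y) (Set.mem_univ _)
  exact ⟨k, hk.trans K.le_succ, h⟩
end

section
/- Let (X,d) be a compact metric space and (X,F) a non-autonomous dynamical system. Then (X,F) is topologically mixing if and only if for each non-empty open set U ⊆ X, the images F_n(U) = f_n ∘ f_{n−1} ∘ ⋯ ∘ f_1(U) converge to X as n → ∞, in the sense that for every ε > 0 there exists N such that for all n ≥ N the set F_n(U) is ε-dense in X (every point of X is within distance ε of a point of F_n(U)). -/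
open Filter Topology Metric

/-- The NDS `(X, F)` is topologically mixing: for all non-empty open `U, V`
there is `K` with `F_n(U) ∩ V ≠ ∅` for all `n ≥ K`. -/
def TopMixing {X : Type*} [TopologicalSpace X] (f : ℕ → X → X) : Prop :=
  ∀ U V : Set X, IsOpen U → U.Nonempty → IsOpen V → V.Nonempty →
    ∃ K : ℕ, ∀ n ≥ K, ((orbitMap f n '' U) ∩ V).Nonempty

/-- The NDS `(X, F)` on a compact metric space is topologically mixing iff for
every non-empty open set `U` the images `F_n(U)` converge to `X`: for every
`ε > 0` there is `N` such that `F_n(U)` is `ε`-dense in `X` for all `n ≥ N`. -/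
theorem topMixing_iff_image_tendsto_dense
    {X : Type*} [MetricSpace X] [CompactSpace X] (f : ℕ → X → X)
    (hf : ∀ n, Continuous (f n)) :
    TopMixing f ↔
      ∀ U : Set X, IsOpen U → U.Nonempty → ∀ ε > (0 : ℝ), ∃ N : ℕ, ∀ n ≥ N,
        ∀ w : X, ∃ u ∈ U, dist (orbitMap f n u) w < ε := by
  constructor
  · intro h U hU hUne ε hε
    obtain ⟨t, -, ht, hcover⟩ := finite_cover_balls_of_compact (isCompact_univ (X := X))
      (half_pos hε)
    have hev : ∀ x ∈ t, ∀ᶠ n in atTop, ((orbitMap f n '' U) ∩ ball x (ε / 2)).Nonempty :=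
      fun x _ => eventually_atTop.2
        (h U (ball x (ε / 2)) hU hUne isOpen_ball ⟨x, mem_ball_self (half_pos hε)⟩)
    obtain ⟨N, hN⟩ := eventually_atTop.1 ((eventually_all_finite ht).2 hev)
    refine ⟨N, fun n hn w => ?_⟩
    obtain ⟨x, hx, hwx⟩ := Set.mem_iUnion₂.1 (hcover (Set.mem_univ w))
    obtain ⟨_, ⟨u, hu, rfl⟩, hux⟩ := hN n hn x hx
    refine ⟨u, hu, ?_⟩
    have := dist_triangle_right (orbitMap f n u) w x
    rw [mem_ball] at hwx hux
    linarith
  · rintro h U V hU hUne hV ⟨v, hv⟩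
    obtain ⟨ε, hε, hball⟩ := Metric.isOpen_iff.1 hV v hv
    obtain ⟨N, hN⟩ := h U hU hUne ε hε
    refine ⟨N, fun n hn => ?_⟩
    obtain ⟨u, hu, huv⟩ := hN n hn v
    exact ⟨_, ⟨u, hu, rfl⟩, hball huv⟩
end
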